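/- SBS implies quantum Darwinism: Let ρ = ∑_{i∈I} p_i |e_i⟩⟨e_i| ⊗ σ_i be a density matrix on ℂ^d ⊗ ℂ^D, where {e_i} is an orthonormal family in ℂ^d, p_i are probabilities, and σ_i are density matrices on ℂ^D with pairwise orthogonal supports, σ_i σ_j = 0 for i ≠ j. Then the quantum mutual information between the two factors equals the entropy of the system: H(ρ_S) + H(ρ_E) − H(ρ) = H(ρ_S), where ρ_S and ρ_E are the partial traces of ρ onto the first and second factor; equivalently, H(ρ) = H(ρ_E), and moreover H(ρ_S) = H((p_i)), the Shannon entropy of the distribution p. -/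

import Mathlib

open scoped Kronecker Matrix ComplexOrder BigOperators
open Matrix

noncomputable section

/-- The rank-one operator `|v⟩⟨w| = v wᴴ`. -/
def ketBra {n : Type*} (v w : n → ℂ) : Matrix n n ℂ := Matrix.vecMulVec v (star w)

/-- A density matrix: positive semidefinite with unit trace. -/
def IsDensityMatrix {n : Type*} [Fintype n] (ρ : Matrix n n ℂ) : Prop :=
  ρ.PosSemidef ∧ ρ.trace = 1

/-- An orthonormal family of vectors. -/
def OrthonormalFamily {n I : Type*} [Fintype n] [DecidableEq I] (e : I → n → ℂ) : Prop :=
  ∀ i j, star (e i) ⬝ᵥ e j = (if i = j then 1 else 0)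

/-- Partial trace over the second (right) tensor factor. -/
def ptraceRight {A B : Type*} [Fintype B] (M : Matrix (A × B) (A × B) ℂ) : Matrix A A ℂ :=
  fun a a' => ∑ b, M (a, b) (a', b)

/-- Partial trace over the first (left) tensor factor. -/
def ptraceLeft {A B : Type*} [Fintype A] (M : Matrix (A × B) (A × B) ℂ) : Matrix B B ℂ :=
  fun b b' => ∑ a, M (a, b) (a, b')

/-- The von Neumann entropy: the Shannon entropy of the eigenvalues (natural log, `0 log 0 = 0`). -/
def vnEntropy {n : Type*} [Fintype n] [DecidableEq n] (ρ : Matrix n n ℂ) : ℝ :=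
  if h : ρ.IsHermitian then ∑ i, Real.negMulLog (h.eigenvalues i) else 0

/-- The Shannon entropy of a finitely supported distribution. -/
def shannonEntropy {I : Type*} [Fintype I] (p : I → ℝ) : ℝ := ∑ i, Real.negMulLog (p i)

theorem vnEntropy_eq_roots {n : Type*} [Fintype n] [DecidableEq n] {M : Matrix n n ℂ}
    (h : M.IsHermitian) :
    vnEntropy M = (M.charpoly.roots.map (fun z : ℂ => Real.negMulLog z.re)).sum := by
  rw [vnEntropy, dif_pos h, h.roots_charpoly_eq_eigenvalues, Multiset.map_map]
  simp

theorem vnEntropy_mul_comm {m n : Type*} [Fintype n] [DecidableEq n] [Fintype m] [DecidableEq m]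
    (A : Matrix m n ℂ) (B : Matrix n m ℂ)
    (h : (A * B).IsHermitian) (h' : (B * A).IsHermitian) :
    vnEntropy (A * B) = vnEntropy (B * A) := by
  rw [vnEntropy_eq_roots h, vnEntropy_eq_roots h']
  have key := congrArg (fun q : Polynomial ℂ =>
    (q.roots.map (fun z : ℂ => Real.negMulLog z.re)).sum) (Matrix.charpoly_mul_comm' A B)
  have hne : ∀ (k : ℕ) (q : Polynomial ℂ), q.Monic → (Polynomial.X ^ k * q) ≠ 0 := fun k q hq =>
    ((Polynomial.monic_X_pow k).mul hq).ne_zero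
  simp only [Polynomial.roots_mul (hne _ _ (Matrix.charpoly_monic _)), Polynomial.roots_X_pow,
    Multiset.map_add, Multiset.sum_add, Multiset.map_nsmul, Multiset.sum_nsmul,
    Multiset.map_singleton, Multiset.sum_singleton, Complex.zero_re, Real.negMulLog_zero,
    smul_zero, zero_add] at key
  exact key

theorem vnEntropy_diagonal {n : Type*} [Fintype n] [DecidableEq n] (p : n → ℝ) :
    vnEntropy (Matrix.diagonal fun i => (p i : ℂ)) = shannonEntropy p := by
  have h : (Matrix.diagonal fun i => (p i : ℂ)).IsHermitian := by
    rw [Matrix.IsHermitian, Matrix.diagonal_conjTranspose]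
    congr 1
    ext i
    simp
  rw [vnEntropy_eq_roots h, Matrix.charpoly_diagonal,
    Polynomial.roots_prod _ _ (by
      simp [Finset.prod_ne_zero_iff, Polynomial.X_sub_C_ne_zero])]
  simp [shannonEntropy]

open scoped MatrixOrder in
theorem exists_herm_sqrt {n : Type*} [Fintype n] [DecidableEq n] {M : Matrix n n ℂ}
    (h : M.PosSemidef) : ∃ T : Matrix n n ℂ, Tᴴ = T ∧ T * T = M := by
  refine ⟨CFC.sqrt M, ?_, CFC.sqrt_mul_sqrt_self M h.nonneg⟩
  exact (Matrix.nonneg_iff_posSemidef.mp (CFC.sqrt_nonneg M)).1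

theorem stmt_11 {d D : ℕ} {I : Type*} [Fintype I] [DecidableEq I]
    (e : I → Fin d → ℂ) (he : OrthonormalFamily e)
    (p : I → ℝ) (hp0 : ∀ i, 0 ≤ p i) (hp1 : ∑ i, p i = 1)
    (σ : I → Matrix (Fin D) (Fin D) ℂ) (hσ : ∀ i, IsDensityMatrix (σ i))
    (horth : ∀ i j, i ≠ j → σ i * σ j = 0)
    (ρ : Matrix (Fin d × Fin D) (Fin d × Fin D) ℂ)
    (hρ : ρ = ∑ i, (p i : ℂ) • (ketBra (e i) (e i) ⊗ₖ σ i)) :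
    vnEntropy (ptraceRight ρ) + vnEntropy (ptraceLeft ρ) - vnEntropy ρ
        = vnEntropy (ptraceRight ρ) ∧
    vnEntropy ρ = vnEntropy (ptraceLeft ρ) ∧
    vnEntropy (ptraceRight ρ) = shannonEntropy p := by
  choose τ hτh hτ using fun i => exists_herm_sqrt (hσ i).1
  have hττ : ∀ i j, i ≠ j → τ i * τ j = 0 := by
    intro i j hij
    have h := horth i j hij
    rw [← hτ i, ← hτ j] at h
    have h1 : (τ i)ᴴ * τ i * (τ j * (τ j)ᴴ) = 0 := by rw [hτh, hτh, h]
    rw [Matrix.conjTranspose_mul_self_mul_eq_zero, ← Matrix.mul_assoc] at h1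
    rw [Matrix.mul_assoc, Matrix.mul_self_mul_conjTranspose_eq_zero] at h1
    exact h1
  -- the environment marginal
  have hE : ptraceLeft ρ = ∑ i, (p i : ℂ) • σ i := by
    ext b b'
    have hn : ∀ i, ∑ a, e i a * star (e i a) = 1 := by
      intro i
      have := he i i
      simpa [dotProduct, mul_comm] using this
    simp only [ptraceLeft, hρ, Matrix.sum_apply, Matrix.smul_apply, Matrix.kroneckerMap_apply,
      ketBra, Matrix.vecMulVec_apply, Pi.star_apply, smul_eq_mul]
    rw [Finset.sum_comm]
    refine Finset.sum_congr rfl fun i _ => ?_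
    rw [← Finset.mul_sum, ← Finset.sum_mul, hn, one_mul]
  -- the system marginal
  have hS : ptraceRight ρ = ∑ i, (p i : ℂ) • ketBra (e i) (e i) := by
    ext a a'
    have hn : ∀ i, ∑ b, σ i b b = 1 := fun i => (hσ i).2
    simp only [ptraceRight, hρ, Matrix.sum_apply, Matrix.smul_apply, Matrix.kroneckerMap_apply,
      smul_eq_mul]
    rw [Finset.sum_comm]
    refine Finset.sum_congr rfl fun i _ => ?_
    rw [← Finset.mul_sum, ← Finset.mul_sum, hn, mul_one]
  have hsq : ∀ i, ((Real.sqrt (p i) : ℝ) : ℂ) * ((Real.sqrt (p i) : ℝ) : ℂ) = (p i : ℂ) := by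
    intro i
    rw [← Complex.ofReal_mul, Real.mul_self_sqrt (hp0 i)]
  -- system entropy
  have h3 : vnEntropy (ptraceRight ρ) = shannonEntropy p := by
    rw [← vnEntropy_diagonal]
    let A : Matrix (Fin d) I ℂ := Matrix.of fun a i => (Real.sqrt (p i) : ℂ) * e i a
    have h1 : A * Aᴴ = ptraceRight ρ := by
      rw [hS]
      ext a a'
      simp only [A, Matrix.mul_apply, Matrix.conjTranspose_apply, Matrix.of_apply,
        Matrix.sum_apply, Matrix.smul_apply, ketBra, Matrix.vecMulVec_apply, Pi.star_apply,
        smul_eq_mul, star_mul', ← hsq]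
      refine Finset.sum_congr rfl fun i _ => ?_
      simp only [RCLike.star_def, Complex.conj_ofReal]
      ring
    have h2 : Aᴴ * A = Matrix.diagonal fun i => (p i : ℂ) := by
      ext i j
      have h := he i j
      simp only [dotProduct, Pi.star_apply] at h
      have : (Aᴴ * A) i j = (Real.sqrt (p i) : ℂ) * (Real.sqrt (p j) : ℂ) *
          ∑ a, star (e i a) * e j a := by
        rw [Finset.mul_sum]
        simp only [A, Matrix.mul_apply, Matrix.conjTranspose_apply, Matrix.of_apply, star_mul']
        refine Finset.sum_congr rfl fun a _ => ?_
        simp only [RCLike.star_def, Complex.conj_ofReal]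
        ring
      rw [this, h, Matrix.diagonal_apply]
      split_ifs with hij
      · subst hij
        rw [mul_one, hsq]
      · simp
    rw [← h1, ← h2]
    exact vnEntropy_mul_comm A Aᴴ (Matrix.isHermitian_mul_conjTranspose_self A)
      (Matrix.isHermitian_conjTranspose_mul_self A)
  -- joint entropy
  have h2 : vnEntropy ρ = vnEntropy (ptraceLeft ρ) := by
    let K : I → Matrix (Fin d × Fin D) (Fin D) ℂ := fun i =>
      Matrix.of fun x c => (Real.sqrt (p i) : ℂ) * (e i x.1 * τ i x.2 c)
    have hst : ∀ i b c, star (τ i b c) = τ i c b := fun i b c => by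
      conv_rhs => rw [← hτh i]
      rfl
    have k1 : ∀ i j, K i * (K j)ᴴ = ((Real.sqrt (p i) : ℂ) * (Real.sqrt (p j) : ℂ)) •
        (ketBra (e i) (e j) ⊗ₖ (τ i * τ j)) := by
      intro i j
      ext x y
      simp only [K, Matrix.mul_apply, Matrix.conjTranspose_apply, Matrix.of_apply, star_mul',
        Matrix.smul_apply, Matrix.kroneckerMap_apply, ketBra, Matrix.vecMulVec_apply,
        Pi.star_apply, smul_eq_mul, hst, Finset.mul_sum]
      refine Finset.sum_congr rfl fun c _ => ?_
      simp only [RCLike.star_def, Complex.conj_ofReal]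
      ring
    have k2 : ∀ i j, (K i)ᴴ * K j = ((Real.sqrt (p i) : ℂ) * (Real.sqrt (p j) : ℂ)) •
        ((star (e i) ⬝ᵥ e j) • (τ i * τ j)) := by
      intro i j
      ext x y
      simp only [K, Matrix.mul_apply, Matrix.conjTranspose_apply, Matrix.of_apply, star_mul',
        Matrix.smul_apply, dotProduct, Pi.star_apply, smul_eq_mul, hst,
        Fintype.sum_prod_type, Finset.sum_mul_sum]
      simp only [Finset.mul_sum]
      refine Finset.sum_congr rfl fun a _ => Finset.sum_congr rfl fun c _ => ?_
      simp only [RCLike.star_def, Complex.conj_ofReal]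
      ring
    let A := ∑ i, K i
    have h1 : A * Aᴴ = ρ := by
      simp only [A, Matrix.conjTranspose_sum, Matrix.sum_mul, Matrix.mul_sum, k1, hρ]
      refine Finset.sum_congr rfl fun i _ => ?_
      rw [Finset.sum_eq_single i]
      · rw [hsq, hτ]
      · intro j _ hj
        first
          | rw [hττ i j hj.symm, Matrix.kronecker_zero, smul_zero]
          | rw [hττ j i hj, Matrix.kronecker_zero, smul_zero]
      · simp
    have h2 : Aᴴ * A = ptraceLeft ρ := by
      simp only [A, Matrix.conjTranspose_sum, Matrix.sum_mul, Matrix.mul_sum, k2, hE]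
      refine Finset.sum_congr rfl fun i _ => ?_
      rw [Finset.sum_eq_single i]
      · rw [hsq, hτ, he, if_pos rfl, one_smul]
      · intro j _ hj
        first
          | rw [hττ i j hj.symm, smul_zero, smul_zero]
          | rw [hττ j i hj, smul_zero, smul_zero]
      · simp
    rw [← h2]
    conv_lhs => rw [← h1]
    exact vnEntropy_mul_comm A Aᴴ (Matrix.isHermitian_mul_conjTranspose_self A)
      (Matrix.isHermitian_conjTranspose_mul_self A)
  exact ⟨by rw [h2]; ring, h2, h3⟩
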